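/- For every n ≥ 1, applying the differential operator ∏_{j=1}^{n} ∂^{2(n−1)}/∂x_j^{2(n−1)} (i.e. the (2n−2)-nd partial derivative in each of the n variables) to the polynomial Δ_n(x)^4 yields the constant polynomial n! · ((2n−2)!)^n · ∏_{j=0}^{n−1} (2j+1). -/

import Mathlib

open Finset MvPolynomial

/-- The Vandermonde determinant `Δ_n(x) = ∏_{a<b} (x_a - x_b)` as a multivariate polynomial. -/
noncomputable def vandermondePoly (n : ℕ) : MvPolynomial (Fin n) ℂ :=
  ∏ a : Fin n, ∏ b ∈ Finset.Ioi a, (X a - X b)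

section LeadingIn

variable {σ R : Type*} [CommRing R] {j : σ}

/-- `q` has leading term `X j ^ d` in the variable `X j`: multiplying by `q` raises degrees in `X j`
by at most `d`, and shifts the top coefficients by `d`. -/
def IsLeadingIn (j : σ) (d : ℕ) (q : MvPolynomial σ R) : Prop :=
  ∀ (p : MvPolynomial σ R) (e : ℕ), degreeOf j p ≤ e → degreeOf j (p * q) ≤ e + d ∧
    ∀ m : σ →₀ ℕ, m j = e → coeff (m + Finsupp.single j d) (p * q) = coeff m p

lemma isLeadingIn_one : IsLeadingIn j 0 (1 : MvPolynomial σ R) :=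
  fun p e hp => by simpa using hp

lemma IsLeadingIn.mul {d₁ d₂ : ℕ} {q₁ q₂ : MvPolynomial σ R} (h₁ : IsLeadingIn j d₁ q₁)
    (h₂ : IsLeadingIn j d₂ q₂) : IsLeadingIn j (d₁ + d₂) (q₁ * q₂) := by
  intro p e hp
  obtain ⟨hd₁, hc₁⟩ := h₁ p e hp
  obtain ⟨hd₂, hc₂⟩ := h₂ (p * q₁) (e + d₁) hd₁
  rw [← mul_assoc, ← add_assoc]
  refine ⟨hd₂, fun m hm => ?_⟩
  rw [Finsupp.single_add, ← add_assoc, hc₂ _ (by simp [hm]), hc₁ m hm]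

lemma IsLeadingIn.pow {d : ℕ} {q : MvPolynomial σ R} (h : IsLeadingIn j d q) (k : ℕ) :
    IsLeadingIn j (k * d) (q ^ k) := by
  induction k with
  | zero => simpa using isLeadingIn_one
  | succ k ih => simpa [pow_succ, add_mul] using ih.mul h

lemma IsLeadingIn.prod {ι : Type*} (s : Finset ι) {d : ι → ℕ} {q : ι → MvPolynomial σ R}
    (h : ∀ i ∈ s, IsLeadingIn j (d i) (q i)) : IsLeadingIn j (∑ i ∈ s, d i) (∏ i ∈ s, q i) := by
  classical
  induction s using Finset.induction_on with
  | empty => simpa using isLeadingIn_one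
  | insert i s hi ih =>
    rw [sum_insert hi, prod_insert hi]
    exact (h i (mem_insert_self _ _)).mul (ih fun k hk => h k (mem_insert_of_mem hk))

lemma isLeadingIn_X_sub_X {i : σ} (hij : j ≠ i) :
    IsLeadingIn j 1 (X j - X i : MvPolynomial σ R) := by
  intro p e hp
  have hi : degreeOf j (p * X i) ≤ e := (degreeOf_mul_X_of_ne p hij).trans_le hp
  rw [mul_sub]
  refine ⟨(degreeOf_sub_le _ _ _).trans (max_le ((degreeOf_mul_X_self j p).trans (by lia))
    (by lia)), fun m hm => ?_⟩
  rw [coeff_sub, coeff_mul_X, sub_eq_self, ← notMem_support_iff]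
  exact notMem_support_of_degreeOf_lt j (by simp [hm]; lia)

end LeadingIn

section Dyson

variable {σ R : Type*} [DecidableEq σ] [CommRing R]

/-- Dyson's product `∏_{i ≠ k} (1 - x_i / x_k) ^ a_i` over `i, k ∈ s`, with denominators cleared. -/
noncomputable def dysonPoly (R : Type*) [CommRing R] (s : Finset σ) (a : σ → ℕ) :
    MvPolynomial σ R :=
  ∏ i ∈ s, ∏ k ∈ s.erase i, (X k - X i) ^ a i

/-- The exponent of the denominator of Dyson's product. -/
noncomputable def dysonExponent (s : Finset σ) (a : σ → ℕ) : σ →₀ ℕ :=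
  ∑ j ∈ s, Finsupp.single j (∑ i ∈ s.erase j, a i)

lemma dysonExponent_apply (s : Finset σ) (a : σ → ℕ) (k : σ) :
    dysonExponent s a k = if k ∈ s then ∑ i ∈ s.erase k, a i else 0 := by
  simp [dysonExponent, Finsupp.finsetSum_apply, Finsupp.single_apply]

lemma dysonPoly_isHomogeneous (s : Finset σ) (a : σ → ℕ) :
    (dysonPoly R s a).IsHomogeneous (∑ i ∈ s, ∑ _k ∈ s.erase i, a i) := by
  refine IsHomogeneous.prod _ _ _ fun i _ => IsHomogeneous.prod _ _ _ fun k _ => ?_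
  simpa using ((isHomogeneous_X R k).sub (isHomogeneous_X R i)).pow (a i)

lemma degreeOf_dysonPoly_of_notMem {s : Finset σ} {j : σ} (hj : j ∉ s) (a : σ → ℕ) :
    degreeOf j (dysonPoly R s a) = 0 := by
  refine Nat.eq_zero_of_le_zero ((degreeOf_prod_le _ _ _).trans
    (sum_nonpos fun i hi => (degreeOf_prod_le _ _ _).trans (sum_nonpos fun k hk => ?_)))
  have hji : j ≠ i := fun h => hj (h ▸ hi)
  have hjk : j ≠ k := fun h => hj (h ▸ mem_of_mem_erase hk)
  have := degreeOf_sub_le j (X k : MvPolynomial σ R) (X i)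
  rw [degreeOf_X_of_ne hji, degreeOf_X_of_ne hjk, max_self, Nat.le_zero] at this
  exact (degreeOf_pow_le _ _ _).trans (by rw [this, mul_zero])

lemma dysonPoly_of_eq_zero {s : Finset σ} {a : σ → ℕ} {j : σ} (hj : j ∈ s) (ha : a j = 0) :
    dysonPoly R s a =
      dysonPoly R (s.erase j) a * ∏ i ∈ s.erase j, (X j - X i) ^ a i := by
  rw [dysonPoly, ← mul_prod_erase s _ hj, dysonPoly]
  simp only [ha, pow_zero, prod_const_one, one_mul]
  rw [← prod_mul_distrib]
  refine prod_congr rfl fun i hi => ?_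
  rw [← prod_erase_mul (s.erase i) _ (mem_erase.2 ⟨(ne_of_mem_erase hi).symm, hj⟩),
    erase_right_comm]

lemma dysonExponent_of_eq_zero {s : Finset σ} {a : σ → ℕ} {j : σ} (hj : j ∈ s) (ha : a j = 0) :
    dysonExponent s a =
      dysonExponent (s.erase j) a + Finsupp.single j (∑ i ∈ s.erase j, a i) := by
  ext k
  simp only [dysonExponent_apply, Finsupp.add_apply, Finsupp.single_apply]
  rcases eq_or_ne j k with rfl | hk
  · simp [hj]
  · simp only [mem_erase, ne_eq, hk.symm, not_false_eq_true, true_and, hk, if_false, add_zero]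
    rw [erase_right_comm, sum_erase _ ha]

lemma coeff_dysonPoly_of_eq_zero {s : Finset σ} {a : σ → ℕ} {j : σ} (hj : j ∈ s)
    (ha : a j = 0) :
    coeff (dysonExponent s a) (dysonPoly R s a) =
      coeff (dysonExponent (s.erase j) a) (dysonPoly R (s.erase j) a) := by
  rw [dysonPoly_of_eq_zero hj ha, dysonExponent_of_eq_zero hj ha]
  have h : IsLeadingIn j (∑ i ∈ s.erase j, a i)
      (∏ i ∈ s.erase j, (X j - X i : MvPolynomial σ R) ^ a i) :=
    IsLeadingIn.prod _ fun i hi => by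
      simpa using (isLeadingIn_X_sub_X (R := R) (ne_of_mem_erase hi).symm).pow (a i)
  exact (h _ 0 (degreeOf_dysonPoly_of_notMem (notMem_erase j s) a).le).2 _
    (by simp [dysonExponent_apply])

lemma dysonPoly_eq_update_mul {s : Finset σ} {a : σ → ℕ} {j : σ} (hj : j ∈ s) (ha : a j ≠ 0) :
    dysonPoly R s a =
      dysonPoly R s (Function.update a j (a j - 1)) * ∏ k ∈ s.erase j, (X k - X j) := by
  obtain ⟨b, hb⟩ := Nat.exists_eq_succ_of_ne_zero ha
  rw [dysonPoly, dysonPoly, ← mul_prod_erase s _ hj, ← mul_prod_erase s _ hj, mul_right_comm]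
  congr 1
  · rw [← prod_mul_distrib]
    exact prod_congr rfl fun k _ => by simp [hb, pow_succ]
  · exact prod_congr rfl fun i hi => by simp [Function.update_of_ne (ne_of_mem_erase hi)]

lemma dysonExponent_eq_update_add {s : Finset σ} {a : σ → ℕ} {j : σ} (hj : j ∈ s)
    (ha : a j ≠ 0) :
    dysonExponent s a = dysonExponent s (Function.update a j (a j - 1)) +
      ∑ i ∈ s.erase j, Finsupp.single i 1 := by
  ext k
  simp only [dysonExponent_apply, Finsupp.add_apply, Finsupp.finsetSum_apply,
    Finsupp.single_apply, sum_ite_eq', mem_erase]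
  rcases eq_or_ne k j with rfl | hk
  · simp only [hj, if_true, ne_eq, not_true_eq_false, false_and, if_false, add_zero]
    exact sum_congr rfl fun i hi => by rw [Function.update_of_ne (ne_of_mem_erase hi)]
  · by_cases hks : k ∈ s
    · have hjk : j ∈ s.erase k := mem_erase.2 ⟨hk.symm, hj⟩
      simp only [hks, hk, if_true, ne_eq, not_false_eq_true, and_self]
      rw [sum_update_of_mem hjk, ← add_sum_erase _ _ hjk, sdiff_singleton_eq_erase]
      lia
    · simp [hks]

/-- Lagrange interpolation of the constant `1`, evaluated at `0`. -/
lemma sum_prod_div_sub_eq_one {F : Type*} [Field F] {s : Finset σ} {v : σ → F}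
    (hv : Set.InjOn v s) (hs : s.Nonempty) :
    ∑ j ∈ s, ∏ i ∈ s.erase j, v i / (v i - v j) = 1 := by
  have h := congrArg (Polynomial.eval 0) (Lagrange.sum_basis hv hs)
  rw [Polynomial.eval_finsetSum, Polynomial.eval_one] at h
  rw [← h]
  refine sum_congr rfl fun j _ => ?_
  rw [Lagrange.basis, Polynomial.eval_prod]
  refine prod_congr rfl fun i _ => ?_
  rw [Lagrange.basisDivisor]
  simp only [Polynomial.eval_mul, Polynomial.eval_C, Polynomial.eval_sub, Polynomial.eval_X]
  rw [← neg_sub (v j) (v i), div_neg, div_eq_mul_inv]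
  ring

lemma dysonPoly_eq_sum_update [IsDomain R] {s : Finset σ} (hs : s.Nonempty) {a : σ → ℕ}
    (ha : ∀ i ∈ s, a i ≠ 0) :
    dysonPoly R s a =
      ∑ j ∈ s, dysonPoly R s (Function.update a j (a j - 1)) * ∏ i ∈ s.erase j, X i := by
  let φ := algebraMap (MvPolynomial σ R) (FractionRing (MvPolynomial σ R))
  have hφ : Function.Injective φ := IsFractionRing.injective _ _
  have hX : Function.Injective fun i => φ (X i) := hφ.comp (X_injective (R := R))
  apply hφ
  rw [← mul_one (φ (dysonPoly R s a)), ← sum_prod_div_sub_eq_one hX.injOn hs, mul_sum, map_sum]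
  refine sum_congr rfl fun j hj => ?_
  rw [dysonPoly_eq_update_mul hj (ha j hj), map_mul, map_mul, map_prod, map_prod, mul_assoc,
    ← prod_mul_distrib]
  congr 1
  refine prod_congr rfl fun i hi => ?_
  have : φ (X i) - φ (X j) ≠ 0 := sub_ne_zero.2 (hX.ne (ne_of_mem_erase hi))
  rw [map_sub, mul_div_cancel₀ _ this]

lemma coeff_dysonPoly_eq_sum_update [IsDomain R] {s : Finset σ} (hs : s.Nonempty) {a : σ → ℕ}
    (ha : ∀ i ∈ s, a i ≠ 0) :
    coeff (dysonExponent s a) (dysonPoly R s a) =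
      ∑ j ∈ s, coeff (dysonExponent s (Function.update a j (a j - 1)))
        (dysonPoly R s (Function.update a j (a j - 1))) := by
  rw [dysonPoly_eq_sum_update hs ha, coeff_sum]
  refine sum_congr rfl fun j hj => ?_
  have hm : (∏ i ∈ s.erase j, X i : MvPolynomial σ R) =
      monomial (∑ i ∈ s.erase j, Finsupp.single i 1) 1 := (monomial_sum_one _ _).symm
  rw [hm, dysonExponent_eq_update_add hj (ha j hj), coeff_mul_monomial, mul_one]

/-- **Dyson's constant term identity** (Good's proof). -/
theorem coeff_dysonPoly_mul_prod_factorial [IsDomain R] (s : Finset σ) (a : σ → ℕ) :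
    coeff (dysonExponent s a) (dysonPoly R s a) * ∏ i ∈ s, ((a i).factorial : R) =
      ((∑ i ∈ s, a i).factorial : R) := by
  induction h : #s + ∑ i ∈ s, a i using Nat.strong_induction_on generalizing s a with
  | _ N ih =>
  rcases s.eq_empty_or_nonempty with rfl | hs
  · simp [dysonPoly, dysonExponent]
  by_cases ha : ∀ i ∈ s, a i ≠ 0
  · have hsum : ∀ j ∈ s, ∑ i ∈ s, a i = ∑ i ∈ s, Function.update a j (a j - 1) i + 1 := by
      intro j hj
      have := ha j hj
      rw [sum_update_of_mem hj, ← add_sum_erase _ _ hj, sdiff_singleton_eq_erase]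
      lia
    have hfact : ∀ j ∈ s, ∏ i ∈ s, ((a i).factorial : R) =
        (∏ i ∈ s, ((Function.update a j (a j - 1) i).factorial : R)) * a j := by
      intro j hj
      rw [← mul_prod_erase _ _ hj, ← mul_prod_erase s _ hj, mul_right_comm,
        Function.update_self, ← Nat.mul_factorial_pred (ha j hj)]
      push_cast
      rw [mul_comm (a j : R)]
      congr 1
      exact prod_congr rfl fun i hi => by rw [Function.update_of_ne (ne_of_mem_erase hi)]
    have hpos : ∑ i ∈ s, a i ≠ 0 := by
      obtain ⟨j, hj⟩ := hs
      rw [hsum j hj]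
      exact Nat.succ_ne_zero _
    rw [coeff_dysonPoly_eq_sum_update hs ha, sum_mul, ← Nat.mul_factorial_pred hpos, Nat.cast_mul,
      Nat.cast_sum, sum_mul]
    refine sum_congr rfl fun j hj => ?_
    have hj' := hsum j hj
    rw [hfact j hj, ← mul_assoc, ih _ (by lia) s _ rfl, hj', Nat.add_sub_cancel, mul_comm]
  · push Not at ha
    obtain ⟨j, hj, haj⟩ := ha
    have hcard := card_erase_add_one hj
    rw [coeff_dysonPoly_of_eq_zero hj haj, ← mul_prod_erase s _ hj, haj, Nat.factorial_zero,
      Nat.cast_one, one_mul, ← sum_erase s haj]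
    exact ih _ (by rw [sum_erase s haj]; lia) _ _ rfl

end Dyson

section IteratedDeriv

variable {σ R : Type*} [CommSemiring R]

lemma iterate_pderiv_monomial (j : σ) (k : ℕ) (m : σ →₀ ℕ) (c : R) :
    (⇑(pderiv j))^[k] (monomial m c) =
      monomial (m - Finsupp.single j k) (c * (m j).descFactorial k) := by
  classical
  induction k with
  | zero => simp
  | succ k ih =>
    rw [Function.iterate_succ_apply', ih, pderiv_monomial, tsub_tsub, ← Finsupp.single_add,
      mul_assoc, Nat.descFactorial_succ]
    simp [mul_comm]

lemma foldr_iterate_pderiv_monomial {l : List σ} (hl : l.Nodup) (k : ℕ) (m : σ →₀ ℕ) (c : R) :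
    l.foldr (fun j p => (⇑(pderiv j))^[k] p) (monomial m c) =
      monomial (m - (l.map fun j => Finsupp.single j k).sum)
        (c * (l.map fun j => ((m j).descFactorial k : R)).prod) := by
  induction l with
  | nil => simp
  | cons j l ih =>
    obtain ⟨hj, hl⟩ := List.nodup_cons.1 hl
    have h0 : (l.map fun i => Finsupp.single i k).sum j = 0 := by
      rw [← Finsupp.applyAddHom_apply, map_list_sum, List.map_map]
      refine List.sum_eq_zero fun x hx => ?_
      obtain ⟨i, hi, rfl⟩ := List.mem_map.1 hx
      exact Finsupp.single_eq_of_ne fun h => hj (h ▸ hi)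
    rw [List.foldr_cons, ih hl, iterate_pderiv_monomial, tsub_tsub, List.map_cons, List.map_cons,
      List.sum_cons, List.prod_cons, Finsupp.tsub_apply, h0, tsub_zero, add_comm, mul_assoc,
      mul_comm (List.prod _)]

lemma foldr_iterate_pderiv_sum {ι : Type*} (l : List σ) (k : ℕ) (s : Finset ι)
    (f : ι → MvPolynomial σ R) :
    l.foldr (fun j p => (⇑(pderiv j))^[k] p) (∑ i ∈ s, f i) =
      ∑ i ∈ s, l.foldr (fun j p => (⇑(pderiv j))^[k] p) (f i) := by
  induction l with
  | nil => rfl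
  | cons j l ih =>
    simp only [List.foldr_cons, ih]
    have h := map_sum ((pderiv (R := R) j).toLinearMap ^ k)
      (fun i => l.foldr (fun j p => (⇑(pderiv j))^[k] p) (f i)) s
    simp only [Module.End.pow_apply] at h
    exact h

/-- Differentiating `k` times in each variable a homogeneous polynomial of degree `n * k` extracts
its coefficient at `(k, …, k)`. -/
lemma foldr_iterate_pderiv_of_isHomogeneous {n k : ℕ} {p : MvPolynomial (Fin n) R}
    (hp : p.IsHomogeneous (n * k)) :
    (List.finRange n).foldr (fun j p => (⇑(pderiv j))^[k] p) p =
      C (coeff (Finsupp.equivFunOnFinite.symm fun _ => k) p * (k.factorial : R) ^ n) := by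
  set d : Fin n →₀ ℕ := Finsupp.equivFunOnFinite.symm fun _ => k with hd
  have hfold : ∀ m : Fin n →₀ ℕ,
      (List.finRange n).foldr (fun j p => (⇑(pderiv j))^[k] p) (monomial m (coeff m p)) =
        monomial (m - d) (coeff m p * ∏ j, ((m j).descFactorial k : R)) := by
    intro m
    have hsum : ((List.finRange n).map fun j => Finsupp.single j k).sum = d := by
      rw [← List.ofFn_eq_map, List.sum_ofFn]
      ext i
      simp [hd, Finsupp.finsetSum_apply, Finsupp.single_apply]
    rw [foldr_iterate_pderiv_monomial (List.nodup_finRange n), hsum, ← List.ofFn_eq_map,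
      List.prod_ofFn]
  conv_lhs => rw [p.as_sum, foldr_iterate_pderiv_sum]
  simp only [hfold]
  rw [sum_eq_single d]
  · simp [hd, Nat.descFactorial_self]
  · intro m hm hmd
    have hdeg : ∑ j, m j = ∑ _j : Fin n, k := by
      rw [← Finsupp.degree_eq_sum, Finsupp.degree_apply, ← hp.degree_eq_sum_deg_support hm]
      simp
    have hlt : ∃ j, m j < k := by
      by_contra! hle
      have := (sum_eq_sum_iff_of_le fun j _ => hle j).1 hdeg.symm
      exact hmd (Finsupp.ext fun j => (this j (mem_univ j)).symm)
    obtain ⟨j, hj⟩ := hlt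
    rw [prod_eq_zero (mem_univ j) (by rw [Nat.descFactorial_of_lt hj, Nat.cast_zero]), mul_zero,
      map_zero]
  · intro hm
    rw [notMem_support_iff.1 hm, zero_mul, map_zero]

end IteratedDeriv

lemma vandermondePoly_pow_four (n : ℕ) :
    vandermondePoly n ^ 4 = dysonPoly ℂ univ fun _ => 2 := by
  have h := prod_prod_Ioi_mul_eq_prod_prod_off_diag
    fun i j : Fin n => (X i - X j : MvPolynomial (Fin n) ℂ) ^ 2
  simp only [compl_singleton] at h
  rw [dysonPoly, ← h, vandermondePoly, ← prod_pow]
  refine prod_congr rfl fun i _ => ?_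
  rw [← prod_pow]
  exact prod_congr rfl fun j _ => by ring

lemma factorial_two_mul_eq (n : ℕ) :
    ((2 * n).factorial : ℂ) =
      (n.factorial : ℂ) * (∏ j ∈ Finset.range n, (2 * (j : ℂ) + 1)) * 2 ^ n := by
  induction n with
  | zero => simp
  | succ n ih =>
    rw [prod_range_succ, mul_add_one, Nat.factorial_succ, Nat.factorial_succ, Nat.factorial_succ]
    push_cast
    rw [ih]
    ring

/-- Eq. (4.18) of the paper: applying `∏_j ∂^{2(n-1)}/∂x_j^{2(n-1)}` to `Δ_n(x)^4` yields the
constant `n! ((2n-2)!)^n ∏_{j=0}^{n-1} (2j+1)`. -/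
theorem deriv_vandermonde_pow_four (n : ℕ) (hn : 1 ≤ n) :
    (List.finRange n).foldr (fun j p => (⇑(pderiv j))^[2 * (n - 1)] p) ((vandermondePoly n) ^ 4)
      = C ((n.factorial : ℂ) * ((2 * n - 2).factorial : ℂ) ^ n *
          ∏ j ∈ Finset.range n, (2 * (j : ℂ) + 1)) := by
  have hhom : (dysonPoly ℂ univ fun _ : Fin n => 2).IsHomogeneous (n * (2 * (n - 1))) := by
    convert dysonPoly_isHomogeneous (R := ℂ) univ fun _ : Fin n => 2 using 1
    simp [mul_comm]
  have hexp : dysonExponent univ (fun _ : Fin n => 2) =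
      Finsupp.equivFunOnFinite.symm fun _ => 2 * (n - 1) := by
    ext k
    simp [dysonExponent_apply, mul_comm]
  have hdyson := coeff_dysonPoly_mul_prod_factorial (R := ℂ) univ fun _ : Fin n => 2
  simp only [prod_const, sum_const, card_univ, Fintype.card_fin, smul_eq_mul, mul_comm n 2,
    Nat.factorial_two, Nat.cast_ofNat, factorial_two_mul_eq] at hdyson
  rw [vandermondePoly_pow_four, foldr_iterate_pderiv_of_isHomogeneous hhom, ← hexp,
    mul_right_cancel₀ (pow_ne_zero n two_ne_zero) hdyson, mul_right_comm, Nat.mul_sub_one]
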